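/- In the model A of O₂ ⊗ O₃, the relative commutant of F in A is trivial: F′ ∩ A = ℂ·1, where F is the C*-subalgebra of A generated by {S_μ S_ν* T_α T_β* : |μ| = |ν|, |α| = |β|}. -/

import Mathlib

open scoped ComplexOrder

/-- The word `S_μ = S_{μ₁} ⋯ S_{μ_k}` associated to a multi-index `μ`. -/
def cuntzWord {A : Type*} [Monoid A] {n : ℕ} (S : Fin n → A) (μ : List (Fin n)) : A :=
  (μ.map S).prod

/-- A state on a C*-algebra: a positive continuous linear functional of norm one. -/
def IsState {A : Type*} [CStarAlgebra A] (f : A →L[ℂ] ℂ) : Prop :=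
  ‖f‖ = 1 ∧ ∀ a : A, 0 ≤ f (star a * a)

/-- The defining property of the canonical state `φ = φ₂ ⊗ φ₃` on the model `A` of `O₂ ⊗ O₃`:
`φ(S_μ S_ν* T_α T_β*) = 2^{-|μ|} 3^{-|α|}` if `μ = ν` and `α = β`, and `0` otherwise. -/
def IsO23State {A : Type*} [CStarAlgebra A] (S : Fin 2 → A) (T : Fin 3 → A)
    (φ : A →L[ℂ] ℂ) : Prop :=
  IsState φ ∧ ∀ (μ ν : List (Fin 2)) (α β : List (Fin 3)),
    φ (cuntzWord S μ * star (cuntzWord S ν) * (cuntzWord T α * star (cuntzWord T β))) =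
      if μ = ν ∧ α = β then ((2 : ℂ) ^ μ.length)⁻¹ * ((3 : ℂ) ^ α.length)⁻¹ else 0

/-- `F = F₂ ⊗ F₃`: the C*-subalgebra of the model `A` of `O₂ ⊗ O₃` generated by
`{S_μ S_ν* T_α T_β* : |μ| = |ν|, |α| = |β|}`. -/
def o23F {A : Type*} [CStarAlgebra A] (S : Fin 2 → A) (T : Fin 3 → A) :
    StarSubalgebra ℂ A :=
  (StarAlgebra.adjoin ℂ {x : A | ∃ (μ ν : List (Fin 2)) (α β : List (Fin 3)),
    μ.length = ν.length ∧ α.length = β.length ∧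
    x = cuntzWord S μ * star (cuntzWord S ν) *
      (cuntzWord T α * star (cuntzWord T β))}).topologicalClosure

section CuntzFamily

variable {A : Type*} {n : ℕ}

theorem cuntzWord_cons [Monoid A] (V : Fin n → A) (i : Fin n) (μ : List (Fin n)) :
    cuntzWord V (i :: μ) = V i * cuntzWord V μ := by
  simp [cuntzWord]

theorem cuntzWord_nil [Monoid A] (V : Fin n → A) : cuntzWord V [] = 1 := by
  simp [cuntzWord]

theorem cuntzWord_append [Monoid A] (V : Fin n → A) (μ ν : List (Fin n)) :
    cuntzWord V (μ ++ ν) = cuntzWord V μ * cuntzWord V ν := by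
  simp [cuntzWord]

theorem cuntzWord_commute [Monoid A] (V : Fin n → A) {a : A} (h : ∀ i, Commute a (V i))
    (μ : List (Fin n)) : Commute a (cuntzWord V μ) := by
  induction μ with
  | nil => simp [cuntzWord_nil]
  | cons i μ ih => rw [cuntzWord_cons]; exact (h i).mul_right ih

/-- Isometries whose range projections sum to one have pairwise orthogonal ranges. -/
theorem star_mul_eq_zero_of_sum_range_proj_eq_one [CStarAlgebra A] {V : Fin n → A}
    (hiso : ∀ i, star (V i) * V i = 1) (hsum : ∑ i, V i * star (V i) = 1)
    {i j : Fin n} (hij : i ≠ j) : star (V i) * V j = 0 := by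
  let _ := CStarAlgebra.spectralOrder A
  let _ := CStarAlgebra.spectralOrderedRing A
  have h1 : ∑ l, star (star (V l) * V j) * (star (V l) * V j) = 1 := by
    calc ∑ l, star (star (V l) * V j) * (star (V l) * V j)
        = star (V j) * (∑ l, V l * star (V l)) * V j := by
          simp [Finset.mul_sum, Finset.sum_mul, mul_assoc]
      _ = 1 := by rw [hsum, mul_one, hiso]
  rw [← Finset.add_sum_erase _ _ (Finset.mem_univ j), hiso, star_one, mul_one,
    add_eq_left, Finset.sum_eq_zero_iff_of_nonneg (fun l _ => star_mul_self_nonneg _)] at h1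
  exact CStarRing.star_mul_self_eq_zero_iff _ |>.1 (h1 i (by simp [hij]))

/-- An element commuting with the matrix units of a Cuntz family has norm at most that of
its compression by one of the isometries. -/
theorem norm_le_norm_star_mul_mul [CStarAlgebra A] {V : Fin n → A}
    (hiso : ∀ i, star (V i) * V i = 1) (hsum : ∑ i, V i * star (V i) = 1) {z : A}
    (hz : ∀ i j, Commute z (V i * star (V j))) (i : Fin n) :
    ‖z‖ ≤ ‖star (V i) * z * V i‖ := by
  have horth {k l : Fin n} (h : k ≠ l) := star_mul_eq_zero_of_sum_range_proj_eq_one hiso hsum h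
  let Φ : A →⋆ₙₐ[ℂ] A :=
    { toFun := fun a => ∑ j, V j * a * star (V j)
      map_smul' := fun c a => by simp [Finset.smul_sum]
      map_zero' := by simp
      map_add' := fun a b => by simp [mul_add, add_mul, Finset.sum_add_distrib]
      map_mul' := fun a b => by
        rw [Finset.sum_mul_sum]
        refine Finset.sum_congr rfl fun k _ => ?_
        rw [Finset.sum_eq_single k]
        · rw [show V k * a * star (V k) * (V k * b * star (V k))
            = V k * a * (star (V k) * V k) * b * star (V k) by simp only [mul_assoc], hiso]
          simp only [mul_assoc, one_mul]
        · intro l _ hl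
          rw [show V k * a * star (V k) * (V l * b * star (V l))
            = V k * a * (star (V k) * V l) * b * star (V l) by simp only [mul_assoc],
            horth hl.symm]
          simp
        · simp
      map_star' := fun a => by simp [mul_assoc] }
  have hΦ : Φ (star (V i) * z * V i) = z := by
    change ∑ j, V j * (star (V i) * z * V i) * star (V j) = z
    calc ∑ j, V j * (star (V i) * z * V i) * star (V j)
        = ∑ j, z * (V j * star (V j)) := by
          refine Finset.sum_congr rfl fun j _ => ?_
          calc V j * (star (V i) * z * V i) * star (V j)
              = (V j * star (V i) * z) * (V i * star (V j)) := by simp only [mul_assoc]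
            _ = z * (V j * (star (V i) * V i) * star (V j)) := by
              rw [← (hz j i).eq]; simp only [mul_assoc]
            _ = z * (V j * star (V j)) := by rw [hiso, mul_one]
      _ = z := by rw [← Finset.mul_sum, hsum, mul_one]
  calc ‖z‖ = ‖Φ (star (V i) * z * V i)‖ := by rw [hΦ]
    _ ≤ _ := NonUnitalStarAlgHom.norm_apply_le Φ _

section Words

variable [Ring A] [StarRing A] {V : Fin n → A} {a b : Fin n}

theorem star_pow_mul_mul_pow_mul_of_lt (hiso : ∀ i, star (V i) * V i = 1)
    (horth : ∀ i j, i ≠ j → star (V i) * V j = 0) (hab : a ≠ b) {p q : ℕ} (hpq : p < q) :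
    star (V a ^ p * V b) * (V a ^ q * V b) = 0 := by
  induction p generalizing q with
  | zero =>
    obtain ⟨q, rfl⟩ := Nat.exists_eq_add_of_lt hpq
    rw [pow_zero, one_mul, pow_succ', mul_assoc, ← mul_assoc, horth b a hab.symm, zero_mul]
  | succ p ih =>
    obtain ⟨q, rfl⟩ : ∃ r, q = r + 1 := ⟨q - 1, by omega⟩
    rw [pow_succ', pow_succ', mul_assoc, star_mul, mul_assoc, mul_assoc (V a),
      ← mul_assoc (star (V a)), hiso, one_mul]
    exact ih (by omega)

theorem star_pow_mul_mul_pow_mul_self (hiso : ∀ i, star (V i) * V i = 1) (p : ℕ) :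
    star (V a ^ p * V b) * (V a ^ p * V b) = 1 := by
  induction p with
  | zero => simpa using hiso b
  | succ p ih =>
    rw [pow_succ', mul_assoc, star_mul, mul_assoc,
      ← mul_assoc (star (V a)), hiso, one_mul, ih]

theorem star_pow_mul_mul_pow_mul (hiso : ∀ i, star (V i) * V i = 1)
    (horth : ∀ i j, i ≠ j → star (V i) * V j = 0) (hab : a ≠ b) (p q : ℕ) :
    star (V a ^ p * V b) * (V a ^ q * V b) = if p = q then 1 else 0 := by
  rcases lt_trichotomy p q with h | rfl | h
  · rw [star_pow_mul_mul_pow_mul_of_lt hiso horth hab h, if_neg h.ne]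
  · rw [star_pow_mul_mul_pow_mul_self hiso, if_pos rfl]
  · rw [← star_star (V a ^ q * V b), ← star_mul,
      star_pow_mul_mul_pow_mul_of_lt hiso horth hab h, if_neg h.ne', star_zero]

theorem star_cuntzWord_mul_pow_mul (hiso : ∀ i, star (V i) * V i = 1)
    (horth : ∀ i j, i ≠ j → star (V i) * V j = 0) (ν : List (Fin n)) {k : ℕ}
    (hk : ν.length ≤ k) :
    star (cuntzWord V ν) * (V a ^ k * V b) = 0 ∨
      star (cuntzWord V ν) * (V a ^ k * V b) = V a ^ (k - ν.length) * V b := by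
  induction ν generalizing k with
  | nil => right; simp [cuntzWord_nil]
  | cons i ν ih =>
    obtain ⟨k, rfl⟩ : ∃ r, k = r + 1 := ⟨k - 1, by simp at hk; omega⟩
    have hk' : ν.length ≤ k := by simpa using hk
    have h : star (cuntzWord V (i :: ν)) * (V a ^ (k + 1) * V b) =
        star (cuntzWord V ν) * ((star (V i) * V a) * (V a ^ k * V b)) := by
      simp only [cuntzWord_cons, star_mul, pow_succ', mul_assoc]
    rw [h]
    by_cases hi : i = a
    · subst hi
      simpa [hiso] using ih hk'
    · left
      rw [horth i a hi]; simp

/-- Compressing a monomial by a long aperiodic word gives `0` or `1`. -/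
theorem compress_cuntzWord (hiso : ∀ i, star (V i) * V i = 1)
    (horth : ∀ i j, i ≠ j → star (V i) * V j = 0) (hab : a ≠ b) (μ ν : List (Fin n)) {k : ℕ}
    (hμ : μ.length ≤ k) (hν : ν.length ≤ k) :
    star (V a ^ k * V b) * (cuntzWord V μ * star (cuntzWord V ν)) * (V a ^ k * V b) = 0 ∨
    star (V a ^ k * V b) * (cuntzWord V μ * star (cuntzWord V ν)) * (V a ^ k * V b) = 1 := by
  have h : star (V a ^ k * V b) * (cuntzWord V μ * star (cuntzWord V ν)) * (V a ^ k * V b) =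
      star (star (cuntzWord V μ) * (V a ^ k * V b)) *
        (star (cuntzWord V ν) * (V a ^ k * V b)) := by
    simp only [star_mul, star_star, mul_assoc]
  rw [h]
  rcases star_cuntzWord_mul_pow_mul (a := a) (b := b) hiso horth μ hμ with h1 | h1
  · simp [h1]
  rcases star_cuntzWord_mul_pow_mul (a := a) (b := b) hiso horth ν hν with h2 | h2
  · simp [h2]
  rw [h1, h2, star_pow_mul_mul_pow_mul hiso horth hab]
  split_ifs <;> simp

/-- Left multiplication by `star (V i)` maps monomials to monomials or to zero. -/
theorem star_mul_cuntzWord_mul_star (hiso : ∀ i, star (V i) * V i = 1)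
    (horth : ∀ i j, i ≠ j → star (V i) * V j = 0) (i : Fin n) (μ ν : List (Fin n)) :
    star (V i) * (cuntzWord V μ * star (cuntzWord V ν)) = 0 ∨
    ∃ μ' ν', star (V i) * (cuntzWord V μ * star (cuntzWord V ν)) =
      cuntzWord V μ' * star (cuntzWord V ν') := by
  cases μ with
  | nil =>
    exact .inr ⟨[], ν ++ [i], by simp [cuntzWord_append, cuntzWord_cons, cuntzWord_nil]⟩
  | cons j μ =>
    rw [cuntzWord_cons, mul_assoc, ← mul_assoc]
    by_cases h : i = j
    · subst h
      exact .inr ⟨μ, ν, by rw [hiso, one_mul]⟩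
    · left; rw [horth i j h, zero_mul]

end Words

end CuntzFamily

section TwoFamilies

variable {A : Type*} {m n : ℕ} {S : Fin m → A} {T : Fin n → A}

/-- The self-adjoint monoid generated by two commuting Cuntz families consists of monomials
in normal form, and zero. -/
theorem eq_zero_or_monomial_of_mem_closure [Ring A] [StarRing A]
    (hSiso : ∀ i, star (S i) * S i = 1) (hSorth : ∀ i j, i ≠ j → star (S i) * S j = 0)
    (hTiso : ∀ i, star (T i) * T i = 1) (hTorth : ∀ i j, i ≠ j → star (T i) * T j = 0)
    (hST : ∀ i j, Commute (S i) (T j)) (hSTstar : ∀ i j, Commute (S i) (star (T j))) {y : A}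
    (hy : y ∈ Submonoid.closure
      (Set.range S ∪ Set.range T ∪ star (Set.range S ∪ Set.range T))) :
    y = 0 ∨ ∃ (μ ν : List (Fin m)) (α β : List (Fin n)),
      y = cuntzWord S μ * star (cuntzWord S ν) * (cuntzWord T α * star (cuntzWord T β)) := by
  have hcT : ∀ (a : A), (∀ i, Commute a (S i)) → (∀ i, Commute (star a) (S i)) →
      ∀ μ ν, Commute a (cuntzWord S μ * star (cuntzWord S ν)) := fun a h h' μ ν =>
    (cuntzWord_commute S h μ).mul_right
      (by simpa using (cuntzWord_commute S h' ν).star_star)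
  induction hy using Submonoid.closure_induction_left with
  | one => exact .inr ⟨[], [], [], [], by simp [cuntzWord_nil]⟩
  | mul_left x hx y _ ih =>
    rcases ih with rfl | ⟨μ, ν, α, β, rfl⟩
    · simp
    rcases hx with (⟨i, rfl⟩ | ⟨j, rfl⟩) | (⟨i, hi⟩ | ⟨j, hj⟩)
    · exact .inr ⟨i :: μ, ν, α, β, by simp only [cuntzWord_cons, mul_assoc]⟩
    · refine .inr ⟨μ, ν, j :: α, β, ?_⟩
      rw [← mul_assoc, (hcT (T j) (fun i => (hST i j).symm)
        (fun i => (hSTstar i j).symm) μ ν).eq]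
      simp only [cuntzWord_cons, mul_assoc]
    · obtain rfl : x = star (S i) := by rw [hi, star_star]
      rw [← mul_assoc]
      rcases star_mul_cuntzWord_mul_star hSiso hSorth i μ ν with h | ⟨μ', ν', h⟩
      · left; rw [h, zero_mul]
      · exact .inr ⟨μ', ν', α, β, by rw [h]⟩
    · obtain rfl : x = star (T j) := by rw [hj, star_star]
      rw [← mul_assoc, (hcT (star (T j)) (fun i => (hSTstar i j).symm)
        (fun i => by simpa using (hST i j).symm) μ ν).eq, mul_assoc]
      rcases star_mul_cuntzWord_mul_star hTiso hTorth j α β with h | ⟨α', β', h⟩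
      · left; rw [h, mul_zero]
      · exact .inr ⟨μ, ν, α', β', by rw [h]⟩

variable [CStarAlgebra A]

/-- Every element of the *-algebra generated by two commuting Cuntz families is compressed to a
scalar by all sufficiently long aperiodic words. -/
theorem eventually_compress_eq_smul_one
    (hSiso : ∀ i, star (S i) * S i = 1) (hSorth : ∀ i j, i ≠ j → star (S i) * S j = 0)
    (hTiso : ∀ i, star (T i) * T i = 1) (hTorth : ∀ i j, i ≠ j → star (T i) * T j = 0)
    (hST : ∀ i j, Commute (S i) (T j)) (hSTstar : ∀ i j, Commute (S i) (star (T j)))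
    {a b : Fin m} (hab : a ≠ b) {c d : Fin n} (hcd : c ≠ d) {y : A}
    (hy : y ∈ StarAlgebra.adjoin ℂ (Set.range S ∪ Set.range T)) :
    ∀ᶠ k in Filter.atTop, ∃ r : ℂ,
      star (S a ^ k * S b * (T c ^ k * T d)) * y * (S a ^ k * S b * (T c ^ k * T d)) =
        r • (1 : A) := by
  rw [← StarSubalgebra.mem_toSubalgebra, StarAlgebra.adjoin_toSubalgebra,
    ← Subalgebra.mem_toSubmodule, Algebra.adjoin_eq_span] at hy
  induction hy using Submodule.span_induction with
  | zero => exact .of_forall fun k => ⟨0, by simp⟩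
  | add x y _ _ hx hy =>
    filter_upwards [hx, hy] with k ⟨r, hr⟩ ⟨s, hs⟩
    exact ⟨r + s, by rw [mul_add, add_mul, hr, hs, add_smul]⟩
  | smul z x _ hx =>
    filter_upwards [hx] with k ⟨r, hr⟩
    exact ⟨z * r, by rw [mul_smul_comm, smul_mul_assoc, hr, mul_smul]⟩
  | mem y hy =>
    rcases eq_zero_or_monomial_of_mem_closure hSiso hSorth hTiso hTorth hST hSTstar hy with
      rfl | ⟨μ, ν, α, β, rfl⟩
    · exact .of_forall fun k => ⟨0, by simp⟩
    filter_upwards [Filter.eventually_ge_atTop μ.length, Filter.eventually_ge_atTop ν.length,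
      Filter.eventually_ge_atTop α.length, Filter.eventually_ge_atTop β.length]
      with k hμ hν hα hβ
    set P := S a ^ k * S b
    set Q := T c ^ k * T d with hQ
    set M := cuntzWord S μ * star (cuntzWord S ν)
    set N := cuntzWord T α * star (cuntzWord T β)
    have hQS : ∀ i, Commute Q (S i) := fun i =>
      ((hST i c).symm.pow_left k).mul_left (hST i d).symm
    have hQS' : ∀ i, Commute (star Q) (S i) := fun i => by
      have h1 : Commute (star (T c)) (S i) := (hSTstar i c).symm
      rw [hQ, star_mul, star_pow]
      exact Commute.mul_left (hSTstar i d).symm (h1.pow_left k)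
    have hQM : Commute (star Q) M := (cuntzWord_commute S hQS' μ).mul_right
      (by simpa using (cuntzWord_commute S hQS ν).star_star)
    have hTS : ∀ {u : A}, (∀ i, Commute u (S i)) → Commute u P := fun h =>
      ((h a).pow_right k).mul_right (h b)
    have hNP : Commute N P := by
      refine hTS fun i => (cuntzWord_commute T (hST i) α).symm.mul_left ?_
      have := cuntzWord_commute T (a := star (S i))
        (fun j => by simpa using (hSTstar i j).star_star) β
      simpa using this.star_star.symm
    have key : star (P * Q) * (M * N) * (P * Q) =
        (star P * M * P) * (star Q * N * Q) := by
      calc star (P * Q) * (M * N) * (P * Q)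
          = star Q * star P * M * (N * P) * Q := by simp only [star_mul, mul_assoc]
        _ = star Q * star P * M * P * N * Q := by rw [hNP.eq]; simp only [mul_assoc]
        _ = star P * star Q * M * P * N * Q := by
          rw [← star_mul, ← (hTS hQS).eq, star_mul]
        _ = star P * (star Q * M) * P * N * Q := by simp only [mul_assoc]
        _ = star P * M * (star Q * P) * N * Q := by rw [hQM.eq]; simp only [mul_assoc]
        _ = _ := by rw [(hTS hQS').eq]; simp only [mul_assoc]
    rw [key]
    rcases compress_cuntzWord hSiso hSorth hab μ ν hμ hν with h1 | h1
    · exact ⟨0, by rw [h1]; simp⟩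
    rcases compress_cuntzWord hTiso hTorth hcd α β hα hβ with h2 | h2
    · exact ⟨0, by rw [h2]; simp⟩
    exact ⟨1, by rw [h1, h2]; simp⟩

end TwoFamilies

section Compression

variable {A : Type*} [CStarAlgebra A]

/-- Compression by `w` preserves the centralizer of `G` and does not decrease distances to
scalars there. -/
def IsExpandingCompression (G : Set A) (w : A) : Prop :=
  ∀ x ∈ Set.centralizer G, star w * x * w ∈ Set.centralizer G ∧
    ∀ c : ℂ, ‖x - c • (1 : A)‖ ≤ ‖star w * x * w - c • (1 : A)‖

namespace IsExpandingCompression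

variable {G : Set A}

theorem one : IsExpandingCompression G (1 : A) := fun x hx => by simp [hx]

theorem mul {v w : A} (hv : IsExpandingCompression G v) (hw : IsExpandingCompression G w) :
    IsExpandingCompression G (v * w) := fun x hx => by
  obtain ⟨h1, h2⟩ := hv x hx
  obtain ⟨h3, h4⟩ := hw _ h1
  have h : star (v * w) * x * (v * w) = star w * (star v * x * v) * w := by
    simp only [star_mul, mul_assoc]
  rw [h]
  exact ⟨h3, fun c => (h2 c).trans (h4 c)⟩

theorem pow {v : A} (hv : IsExpandingCompression G v) (k : ℕ) :
    IsExpandingCompression G (v ^ k) := by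
  induction k with
  | zero => simpa using one
  | succ k ih => rw [pow_succ]; exact ih.mul hv

theorem of_cuntz {n : ℕ} {V : Fin n → A}
    (hiso : ∀ i, star (V i) * V i = 1) (hsum : ∑ i, V i * star (V i) = 1)
    (hV : ∀ i j, V i * star (V j) ∈ G) (hG : ∀ i, ∀ y ∈ G, V i * y * star (V i) ∈ G)
    (i : Fin n) : IsExpandingCompression G (V i) := fun x hx => by
  constructor
  · intro y hy
    have h : V i * y * star (V i) * x = x * (V i * y * star (V i)) := hx _ (hG i y hy)
    calc y * (star (V i) * x * V i)
        = (star (V i) * V i) * y * (star (V i) * x * V i) := by rw [hiso, one_mul]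
      _ = star (V i) * (V i * y * star (V i) * x) * V i := by simp only [mul_assoc]
      _ = star (V i) * x * V i * y * (star (V i) * V i) := by rw [h]; simp only [mul_assoc]
      _ = star (V i) * x * V i * y := by rw [hiso, mul_one]
  · intro c
    have hz : ∀ k l, Commute (x - c • (1 : A)) (V k * star (V l)) := fun k l =>
      Commute.sub_left (hx _ (hV k l)).symm ((Commute.one_left _).smul_left c)
    convert norm_le_norm_star_mul_mul hiso hsum hz i using 2
    rw [mul_sub, sub_mul, mul_smul_comm, smul_mul_assoc, mul_one, hiso]

end IsExpandingCompression

end Compression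

/-- The relative commutant of `F = F₂ ⊗ F₃` in the model `A` of `O₂ ⊗ O₃` is trivial:
every `x ∈ A` commuting with all elements of `F` is a scalar multiple of the identity. -/
theorem o23_relative_commutant_trivial {A : Type*} [CStarAlgebra A]
    (S : Fin 2 → A) (T : Fin 3 → A)
    (hSiso : ∀ i, star (S i) * S i = 1) (hSsum : ∑ i, S i * star (S i) = 1)
    (hTiso : ∀ j, star (T j) * T j = 1) (hTsum : ∑ j, T j * star (T j) = 1)
    (hST : ∀ i j, S i * T j = T j * S i)
    (hSTstar : ∀ i j, S i * star (T j) = star (T j) * S i)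
    (hgen : (StarAlgebra.adjoin ℂ (Set.range S ∪ Set.range T)).topologicalClosure = ⊤)
    (x : A) (hx : ∀ y ∈ o23F S T, x * y = y * x) :
    ∃ c : ℂ, x = c • (1 : A) := by
  have hSorth (i j : Fin 2) (h : i ≠ j) :=
    star_mul_eq_zero_of_sum_range_proj_eq_one hSiso hSsum h
  have hTorth (i j : Fin 3) (h : i ≠ j) :=
    star_mul_eq_zero_of_sum_range_proj_eq_one hTiso hTsum h
  let G : Set A := {x : A | ∃ (μ ν : List (Fin 2)) (α β : List (Fin 3)),
    μ.length = ν.length ∧ α.length = β.length ∧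
    x = cuntzWord S μ * star (cuntzWord S ν) *
      (cuntzWord T α * star (cuntzWord T β))}
  have hxG : x ∈ Set.centralizer G := fun y hy =>
    (hx y (StarSubalgebra.le_topologicalClosure _ (StarAlgebra.subset_adjoin ℂ _ hy))).symm
  have hES : ∀ i, IsExpandingCompression G (S i) := by
    refine .of_cuntz hSiso hSsum
      (fun i j => ⟨[i], [j], [], [], rfl, rfl, by simp [cuntzWord_cons, cuntzWord_nil]⟩) ?_
    rintro i _ ⟨μ, ν, α, β, h1, h2, rfl⟩
    refine ⟨i :: μ, i :: ν, α, β, by simp [h1], h2, ?_⟩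
    have hα := cuntzWord_commute T (a := star (S i))
      (fun j => by simpa using (show Commute (S i) (star (T j)) from hSTstar i j).star_star) α
    have hβ : Commute (star (S i)) (star (cuntzWord T β)) :=
      (cuntzWord_commute T (hST i) β).star_star
    have h := (hα.mul_right hβ).eq
    simp only [cuntzWord_cons, star_mul, mul_assoc] at h ⊢
    rw [h]
  have hET : ∀ j, IsExpandingCompression G (T j) := by
    refine .of_cuntz hTiso hTsum
      (fun i j => ⟨[], [], [i], [j], rfl, rfl, by simp [cuntzWord_cons, cuntzWord_nil]⟩) ?_
    rintro j _ ⟨μ, ν, α, β, h1, h2, rfl⟩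
    refine ⟨μ, ν, j :: α, j :: β, h1, by simp [h2], ?_⟩
    have hμ := cuntzWord_commute S (a := T j) (fun i => (hST i j).symm) μ
    have hν := cuntzWord_commute S (a := star (T j)) (fun i => (hSTstar i j).symm) ν
    have h := (hμ.mul_right (by simpa using hν.star_star)).eq
    rw [← mul_assoc (T j), h]
    simp only [cuntzWord_cons, star_mul, mul_assoc]
  have hclosed : IsClosed ((Submodule.span ℂ {(1 : A)} : Submodule ℂ A) : Set A) :=
    Submodule.closed_of_finiteDimensional _
  suffices hmem : x ∈ Submodule.span ℂ {(1 : A)} by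
    obtain ⟨c, hc⟩ := Submodule.mem_span_singleton.1 hmem
    exact ⟨c, hc.symm⟩
  rw [← SetLike.mem_coe, ← hclosed.closure_eq, Metric.mem_closure_iff]
  intro ε hε
  have hxcl : x ∈ closure ((StarAlgebra.adjoin ℂ (Set.range S ∪ Set.range T) :
      StarSubalgebra ℂ A) : Set A) := by
    rw [← StarSubalgebra.topologicalClosure_coe, hgen]
    exact StarSubalgebra.mem_top
  obtain ⟨y, hy, hxy⟩ := Metric.mem_closure_iff.1 hxcl ε hε
  obtain ⟨k, c, hk⟩ := (eventually_compress_eq_smul_one hSiso hSorth hTiso hTorth hST hSTstar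
    (show (0 : Fin 2) ≠ 1 by decide) (show (0 : Fin 3) ≠ 1 by decide) hy).exists
  refine ⟨c • 1, Submodule.smul_mem _ _ (Submodule.mem_span_singleton_self _), ?_⟩
  have hSw := star_pow_mul_mul_pow_mul_self (a := 0) (b := 1) hSiso k
  have hTw := star_pow_mul_mul_pow_mul_self (a := 0) (b := 1) hTiso k
  set w := S 0 ^ k * S 1 * (T 0 ^ k * T 1) with hw
  have hwiso : star w * w = 1 := by
    rw [hw, star_mul, mul_assoc, ← mul_assoc (star (S 0 ^ k * S 1)), hSw, one_mul, hTw]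
  have hwnorm : ‖w‖ ≤ 1 := by
    nontriviality A
    have h := CStarRing.norm_star_mul_self (x := w)
    rw [hwiso, CStarRing.norm_one] at h
    nlinarith [norm_nonneg w]
  have hEw : IsExpandingCompression G w :=
    (((hES 0).pow k).mul (hES 1)).mul (((hET 0).pow k).mul (hET 1))
  rw [dist_eq_norm] at hxy ⊢
  calc ‖x - c • (1 : A)‖ ≤ ‖star w * x * w - c • (1 : A)‖ := (hEw x hxG).2 c
    _ = ‖star w * (x - y) * w‖ := by rw [← hk, mul_sub, sub_mul]
    _ ≤ ‖star w‖ * ‖x - y‖ * ‖w‖ := norm_mul₃_le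
    _ ≤ 1 * ‖x - y‖ * 1 := by
      have hwstar : ‖star w‖ ≤ 1 := by rwa [norm_star]
      gcongr
    _ < ε := by simpa using hxy
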